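/- Let S(n) := Σ_{j=1}^{n-1} (-1)^{j-1} C(n-1, j) / h_j, where h_j = Σ_{i=1}^j 1/i. Let 0 > s₁ > s₂ > ... be the negative roots of ψ(s) = ψ(1), with s_i ∈ (-i, -(i-1)). Then for every fixed integer N ≥ 0 there is a constant C_N such that for all n ≥ 2, |S(n) - (6/π²)·h_{n-1} - ζ(3)/ζ(2)² + Σ_{i=1}^N (Γ(|s_i|+1)/ψ'(s_i)) · Γ(n)/Γ(n+|s_i|+1)| ≤ C_N · n^{-1-|s_{N+1}|}. -/

import Mathlib

/-- The digamma function on the reals: `ψ(x) = Γ'(x)/Γ(x)`. -/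
noncomputable def digamma (x : ℝ) : ℝ := deriv Real.Gamma x / Real.Gamma x

/-- The `m`-th harmonic number `h_m = ∑_{i=1}^m 1/i`, with `h_0 = 0`. -/
noncomputable def harm (m : ℕ) : ℝ := ∑ i ∈ Finset.range m, (1 : ℝ) / (i + 1)

/-- `S(n) = Σ_{j=1}^{n-1} (-1)^{j-1} C(n-1, j) / h_j` (equal to `E[D_n]` in the paper). -/
noncomputable def S (n : ℕ) : ℝ :=
  ∑ j ∈ Finset.Icc 1 (n - 1), (-1 : ℝ) ^ (j - 1) * ((n - 1).choose j) / harm j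

/-- `ζ(3) = Σ_{k≥1} k⁻³`. -/
noncomputable def zeta3 : ℝ := ∑' k : ℕ, (1 : ℝ) / ((k : ℝ) + 1) ^ 3

open Filter Topology

/-- truncated digamma difference -/
noncomputable def phiK (K : ℕ) (x : ℝ) : ℝ :=
  ∑ k ∈ Finset.range K, (1 / ((k : ℝ) + 1) - 1 / ((k : ℝ) + x))

lemma digamma_add_one {x : ℝ} (hx : ∀ m : ℕ, x ≠ -m) :
    digamma (x + 1) = digamma x + 1 / x := by
  have hx0 : x ≠ 0 := by simpa using hx 0
  have hx1 : ∀ m : ℕ, x + 1 ≠ -m := by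
    intro m h
    apply hx (m + 1)
    push_cast; linarith
  have h1 : HasDerivAt (fun y => Real.Gamma (y + 1)) (deriv Real.Gamma (x + 1)) x := by
    have := (Real.differentiableAt_Gamma hx1).hasDerivAt
    exact this.comp_add_const x 1
  have h2 : HasDerivAt (fun y => y * Real.Gamma y) (1 * Real.Gamma x + x * deriv Real.Gamma x) x :=
    (hasDerivAt_id x).mul (Real.differentiableAt_Gamma hx).hasDerivAt
  have h3 : (fun y => Real.Gamma (y + 1)) =ᶠ[𝓝 x] (fun y => y * Real.Gamma y) := by
    filter_upwards [isOpen_ne.mem_nhds hx0] with y hy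
    exact Real.Gamma_add_one hy
  have h4 := h1.unique (h2.congr_of_eventuallyEq h3)
  have hG : Real.Gamma x ≠ 0 := Real.Gamma_ne_zero hx
  unfold digamma
  rw [h4, Real.Gamma_add_one hx0]
  field_simp
  ring

lemma digamma_add_nat {x : ℝ} (hx : ∀ m : ℕ, x ≠ -m) (K : ℕ) :
    digamma (x + K) = digamma x + ∑ k ∈ Finset.range K, 1 / ((k : ℝ) + x) := by
  induction K with
  | zero => simp
  | succ K ih =>
    rw [Finset.sum_range_succ, ← add_assoc, ← ih]
    have : ∀ m : ℕ, x + K ≠ -m := by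
      intro m h
      apply hx (m + K)
      push_cast; linarith
    have := digamma_add_one this
    rw [Nat.cast_succ, ← add_assoc, this, add_comm x]

lemma digamma_mono {x y : ℝ} (hx : 0 < x) (hxy : x ≤ y) : digamma x ≤ digamma y := by
  have hne : ∀ z : ℝ, 0 < z → ∀ m : ℕ, z ≠ -m := by
    intro z hz m h
    have : (0 : ℝ) ≤ m := m.cast_nonneg
    linarith
  have hd : ∀ z ∈ Set.Ioi (0 : ℝ), HasDerivAt (Real.log ∘ Real.Gamma) (digamma z) z := by
    intro z hz
    exact (Real.differentiableAt_Gamma (hne z hz)).hasDerivAt.log (Real.Gamma_ne_zero (hne z hz))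
  have := Real.convexOn_log_Gamma.monotoneOn_deriv (fun z hz => (hd z hz).differentiableAt)
  have h := this (Set.mem_Ioi.2 hx) (Set.mem_Ioi.2 (hx.trans_le hxy)) hxy
  rwa [(hd x hx).deriv, (hd y (hx.trans_le hxy)).deriv] at h

lemma tendsto_phiK {x : ℝ} (hx : ∀ m : ℕ, x ≠ -m) :
    Tendsto (fun K => phiK K x) atTop (𝓝 (digamma x - digamma 1)) := by
  have hne : ∀ z : ℝ, 0 < z → ∀ m : ℕ, z ≠ -m := by
    intro z hz m h
    have : (0 : ℝ) ≤ m := m.cast_nonneg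
    linarith
  obtain ⟨M, hM⟩ := exists_nat_ge |x|
  have hM' := abs_le.1 hM
  have key : Tendsto (fun K : ℕ => digamma (x + K) - digamma (1 + K)) atTop (𝓝 0) := by
    rw [← tendsto_add_atTop_iff_nat (M + 1)]
    have lim : ∀ (A : ℕ) (c : ℝ), Tendsto (fun L : ℕ =>
        ∑ k ∈ Finset.range A, 1 / ((k : ℝ) + ((L : ℝ) + c))) atTop (𝓝 0) := by
      intro A c
      have : Tendsto (fun L : ℕ =>
        ∑ k ∈ Finset.range A, 1 / ((k : ℝ) + ((L : ℝ) + c))) atTop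
          (𝓝 (∑ k ∈ Finset.range A, (0 : ℝ))) := by
        apply tendsto_finsetSum
        intro k _
        simp only [one_div]
        apply tendsto_inv_atTop_zero.comp
        apply tendsto_atTop_add_const_left
        apply tendsto_atTop_add_const_right
        exact tendsto_natCast_atTop_atTop
      simpa using this
    have lo := (lim (M + 1) 1).neg
    have hi := lim M (M + 2)
    rw [neg_zero] at lo
    refine tendsto_of_tendsto_of_tendsto_of_le_of_le lo hi ?_ ?_
    · intro L
      have h1 := digamma_add_nat (hne ((L : ℝ) + 1) (by positivity)) (M + 1)
      have h2 : digamma ((L : ℝ) + 1) ≤ digamma (x + ((L + (M + 1) : ℕ) : ℝ)) := by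
        apply digamma_mono (by positivity)
        push_cast; linarith
      have h3 : (L : ℝ) + 1 + ((M + 1 : ℕ) : ℝ) = 1 + ((L + (M + 1) : ℕ) : ℝ) := by
        push_cast; ring
      rw [h3] at h1
      simp only
      linarith
    · intro L
      have h1 := digamma_add_nat (hne ((L : ℝ) + (M + 2)) (by positivity)) M
      have h2 : digamma (x + ((L + (M + 1) : ℕ) : ℝ)) ≤ digamma ((L : ℝ) + (M + 2) + M) := by
        apply digamma_mono
        · push_cast; linarith [(L.cast_nonneg : (0 : ℝ) ≤ L)]
        · push_cast; linarith
      have h3 : (L : ℝ) + (M + 2) = 1 + ((L + (M + 1) : ℕ) : ℝ) := by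
        push_cast; ring
      rw [h3] at h1 h2
      simp only
      rw [h3]
      linarith
  have h : ∀ K : ℕ, phiK K x = digamma x - digamma 1 - (digamma (x + K) - digamma (1 + K)) := by
    intro K
    rw [digamma_add_nat hx, digamma_add_nat (hne 1 one_pos), phiK, Finset.sum_sub_distrib]
    ring
  simp_rw [h]
  simpa using key.const_sub (digamma x - digamma 1)

lemma digamma_nat (j : ℕ) : digamma ((j : ℝ) + 1) - digamma 1 = harm j := by
  have h := digamma_add_nat (x := 1) (by
    intro m h
    have : (0 : ℝ) ≤ m := m.cast_nonneg
    linarith) j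
  rw [add_comm, h, harm]
  ring

/-- Distance of a nonpole to the poles. -/
lemma window {i : ℕ} {s : ℝ} (hs : s ∈ Set.Ioo (-(i : ℝ)) (-(i : ℝ) + 1)) :
    ∃ d > 0, ∀ k : ℕ, d ≤ |(k : ℝ) + s| := by
  refine ⟨min (s + i) (-(i : ℝ) + 1 - s), lt_min (by linarith [hs.1]) (by linarith [hs.2]), ?_⟩
  intro k
  rcases le_or_gt i k with h | h
  · have : (i : ℝ) ≤ k := by exact_mod_cast h
    refine (min_le_left _ _).trans (le_trans ?_ (le_abs_self _))
    linarith
  · have : (k : ℝ) + 1 ≤ i := by exact_mod_cast h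
    refine (min_le_right _ _).trans (le_trans ?_ (neg_le_abs _))
    linarith

lemma window_bound {s d x : ℝ} (hd : 0 < d) (hs : ∀ k : ℕ, d ≤ |(k : ℝ) + s|)
    (hx : |x - s| < d / 2) (k : ℕ) :
    (k : ℝ) + x ≠ 0 ∧ 1 / ((k : ℝ) + x) ^ 2 ≤ 4 * (1 / ((k : ℝ) + s) ^ 2) := by
  have h1 : |(k : ℝ) + s| / 2 ≤ |(k : ℝ) + x| := by
    have : |(k : ℝ) + s| ≤ |(k : ℝ) + x| + |x - s| := by
      have := abs_sub ((k : ℝ) + x) (x - s)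
      have e : (k : ℝ) + x - (x - s) = k + s := by ring
      rwa [e] at this
    linarith [hs k]
  have h0 : 0 < |(k : ℝ) + s| := hd.trans_le (hs k)
  have h2 : 0 < |(k : ℝ) + x| := by linarith
  refine ⟨abs_pos.1 h2, ?_⟩
  rw [← sq_abs ((k : ℝ) + x), ← sq_abs ((k : ℝ) + s)]
  rw [mul_one_div, div_le_div_iff₀ (by positivity) (by positivity)]
  nlinarith

lemma summable_sq (s : ℝ) : Summable (fun k : ℕ => 1 / ((k : ℝ) + s) ^ 2) := by
  have := (Real.summable_one_div_nat_add_rpow s 2).2 (by norm_num)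
  refine this.congr ?_
  intro k
  rw [Real.rpow_two, sq_abs]

lemma hasDerivAt_phiK {x : ℝ} (hx : ∀ k : ℕ, (k : ℝ) + x ≠ 0) (K : ℕ) :
    HasDerivAt (phiK K) (∑ k ∈ Finset.range K, 1 / ((k : ℝ) + x) ^ 2) x := by
  unfold phiK
  apply HasDerivAt.fun_sum
  intro k _
  have h := (((hasDerivAt_id x).const_add (k : ℝ)).inv (hx k)).const_sub (1 / ((k : ℝ) + 1))
  simp only [one_div]
  simp only [one_div, id] at h
  refine h.congr_deriv ?_
  rw [neg_div, neg_neg, one_div]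

lemma hasDerivAt_digamma {i : ℕ} {s : ℝ} (hs : s ∈ Set.Ioo (-(i : ℝ)) (-(i : ℝ) + 1)) :
    HasDerivAt digamma (∑' k : ℕ, 1 / ((k : ℝ) + s) ^ 2) s := by
  obtain ⟨d, hd, hw⟩ := window hs
  have hb : ∀ x ∈ Metric.ball s (d / 2), |x - s| < d / 2 := fun x hx => by
    simpa [Real.dist_eq] using hx
  have hu : TendstoUniformlyOn (fun K : ℕ => fun x : ℝ => ∑ k ∈ Finset.range K, 1 / ((k : ℝ) + x) ^ 2)
      (fun x => ∑' k : ℕ, 1 / ((k : ℝ) + x) ^ 2) atTop (Metric.ball s (d / 2)) := by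
    apply tendstoUniformlyOn_tsum_nat (u := fun k : ℕ => 4 * (1 / ((k : ℝ) + s) ^ 2))
    · exact (summable_sq s).mul_left 4
    · intro k x hx
      rw [Real.norm_of_nonneg (by positivity)]
      exact (window_bound hd hw (hb x hx) k).2
  have := hasDerivAt_of_tendstoUniformlyOn (f := phiK) (g := fun x => digamma x - digamma 1)
    Metric.isOpen_ball hu (Eventually.of_forall fun K x hx =>
      hasDerivAt_phiK (fun k => (window_bound hd hw (hb x hx) k).1) K)
    (fun x hx => tendsto_phiK (fun m h => (window_bound hd hw (hb x hx) m).1 (by rw [h, add_neg_cancel])))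
    (Metric.mem_ball_self (by positivity))
  simpa using this.add_const (digamma 1)

open Polynomial in
lemma partial_fractions {K : ℕ} (hK : 1 ≤ K) (v : ℕ → ℝ)
    (hinj : Set.InjOn v (Finset.range K : Set ℕ))
    (hv : ∀ i < K, ∀ k : ℕ, (k : ℝ) + v i ≠ 0) (hroot : ∀ i < K, phiK K (v i) = 0)
    {x : ℝ} (hx : ∀ k : ℕ, (k : ℝ) + x ≠ 0) (hxv : ∀ i < K, x ≠ v i) :
    1 / phiK K x = 1 / harm K + ∑ i ∈ Finset.range K,
      1 / (∑ k ∈ Finset.range K, 1 / ((k : ℝ) + v i) ^ 2) / (x - v i) := by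
  set h := harm K with hh
  have hpos : 0 < h := by
    rw [hh, harm]
    apply Finset.sum_pos
    · intro i _; positivity
    · simpa using (by omega : K ≠ 0)
  set Q : ℝ[X] := Lagrange.nodal (Finset.range K) (fun k : ℕ => -(k : ℝ)) with hQ
  set R : ℝ[X] := Lagrange.nodal (Finset.range K) v with hR
  set P : ℝ[X] := C h * Q - derivative Q with hP
  have evQ : ∀ y, Q.eval y = ∏ k ∈ Finset.range K, ((k : ℝ) + y) := by
    intro y
    rw [hQ, Lagrange.eval_nodal]
    apply Finset.prod_congr rfl
    intro k _; ring
  have Qne : ∀ y, (∀ k < K, (k : ℝ) + y ≠ 0) → Q.eval y ≠ 0 := by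
    intro y hy
    rw [evQ]
    exact Finset.prod_ne_zero_iff.2 (fun k hk => hy k (Finset.mem_range.1 hk))
  have evQ' : ∀ y, (∀ k < K, (k : ℝ) + y ≠ 0) →
      (derivative Q).eval y = Q.eval y * ∑ k ∈ Finset.range K, 1 / ((k : ℝ) + y) := by
    intro y hy
    rw [hQ, Lagrange.derivative_nodal, eval_finsetSum, Finset.mul_sum]
    apply Finset.sum_congr rfl
    intro k hk
    rw [Lagrange.nodal_eq_mul_nodal_erase hk]
    have := hy k (Finset.mem_range.1 hk)
    simp only [eval_mul, eval_sub, eval_X, eval_C]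
    rw [sub_neg_eq_add, add_comm y]
    field_simp
  have evP : ∀ y, (∀ k < K, (k : ℝ) + y ≠ 0) → P.eval y = Q.eval y * phiK K y := by
    intro y hy
    rw [hP, eval_sub, evQ' y hy, eval_mul, eval_C, phiK, Finset.sum_sub_distrib, hh, harm]
    ring
  have hdegQ' : (derivative Q).degree < (Finset.range K).card := by
    have : Q ≠ 0 := Lagrange.nodal_ne_zero
    have h1 := degree_derivative_lt this
    rwa [hQ, Lagrange.degree_nodal, ← hQ] at h1
  have hPR : P = C h * R := by
    apply Polynomial.eq_of_degree_sub_lt_of_eval_index_eq (Finset.range K) hinj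
    · have e : P - C h * R = C h * (Q - R) - derivative Q := by rw [hP]; ring
      rw [e]
      refine (degree_sub_le _ _).trans_lt (max_lt ?_ hdegQ')
      rw [degree_C_mul hpos.ne']
      have := degree_sub_lt_left (p := Q) (q := R)
        (by rw [hQ, hR, Lagrange.degree_nodal, Lagrange.degree_nodal])
        Lagrange.nodal_ne_zero
        (by rw [hQ, hR, Lagrange.nodal_monic.leadingCoeff, Lagrange.nodal_monic.leadingCoeff])
      rwa [hQ, Lagrange.degree_nodal, ← hQ] at this
    · intro i hi
      have hi' := Finset.mem_range.1 hi
      rw [evP _ (fun k _ => hv i hi' k), hroot i hi', eval_mul, hR, Lagrange.eval_nodal_at_node hi]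
      simp
  have hderiv : ∀ i < K, h * (derivative R).eval (v i) =
      Q.eval (v i) * (∑ k ∈ Finset.range K, 1 / ((k : ℝ) + v i) ^ 2) := by
    intro i hi
    have h1 : HasDerivAt (fun y => P.eval y) ((derivative P).eval (v i)) (v i) := P.hasDerivAt (v i)
    have h2 := (Q.hasDerivAt (v i)).mul (hasDerivAt_phiK (hv i hi) K)
    have h3 : (fun y => P.eval y) =ᶠ[𝓝 (v i)] ((fun y => Q.eval y) * phiK K) := by
      have : ∀ᶠ y in 𝓝 (v i), ∀ k ∈ Finset.range K, (k : ℝ) + y ≠ 0 := by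
        rw [Finset.eventually_all]
        intro k _
        have hc : ContinuousAt (fun y : ℝ => (k : ℝ) + y) (v i) := by fun_prop
        exact hc.eventually_ne (hv i hi k)
      filter_upwards [this] with y hy
      exact evP y (fun k hk => hy k (Finset.mem_range.2 hk))
    have h4 := h1.unique (h2.congr_of_eventuallyEq h3)
    rw [hroot i hi, hPR, derivative_C_mul, eval_mul, eval_C] at h4
    rw [h4]; ring
  have hD : ∀ i < K, (∑ k ∈ Finset.range K, 1 / ((k : ℝ) + v i) ^ 2) ≠ 0 := by
    intro i hi
    apply ne_of_gt
    apply Finset.sum_pos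
    · intro k _
      have := hv i hi k
      positivity
    · simpa using (by omega : K ≠ 0)
  have hRx : R.eval x ≠ 0 := Lagrange.eval_nodal_not_at_node
    (fun i hi => hxv i (Finset.mem_range.1 hi))
  have hint : (derivative Q).eval x = R.eval x * ∑ i ∈ Finset.range K,
      h ^ 2 * (1 / (∑ k ∈ Finset.range K, 1 / ((k : ℝ) + v i) ^ 2) / (x - v i)) := by
    conv_lhs => rw [Lagrange.eq_interpolate hinj hdegQ']
    rw [Lagrange.eval_interpolate_not_at_node _ (fun i hi => hxv i (Finset.mem_range.1 hi)), ← hR]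
    congr 1
    apply Finset.sum_congr rfl
    intro i hi
    have hi' := Finset.mem_range.1 hi
    rw [Lagrange.nodalWeight_eq_eval_derivative_nodal hi, ← hR]
    have hz := evP (v i) (fun k _ => hv i hi' k)
    rw [hroot i hi', mul_zero, hP, eval_sub, eval_mul, eval_C, sub_eq_zero] at hz
    rw [← hz]
    have hd := hderiv i hi'
    have hq := Qne (v i) (fun k _ => hv i hi' k)
    have hDi := hD i hi'
    have hxi : x - v i ≠ 0 := sub_ne_zero.2 (hxv i hi')
    have hRd : (derivative R).eval (v i) =
      Q.eval (v i) * (∑ k ∈ Finset.range K, 1 / ((k : ℝ) + v i) ^ 2) / h := by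
      field_simp; linarith
    rw [hRd]
    field_simp
  rw [← Finset.mul_sum] at hint
  have hQx := Qne x (fun k _ => hx k)
  have e1 := evP x (fun k _ => hx k)
  have e2 : P.eval x = h * Q.eval x - (derivative Q).eval x := by
    rw [hP, eval_sub, eval_mul, eval_C]
  have e3 : P.eval x = h * R.eval x := by rw [hPR, eval_mul, eval_C]
  set T := ∑ i ∈ Finset.range K, 1 / (∑ k ∈ Finset.range K, 1 / ((k : ℝ) + v i) ^ 2) / (x - v i)
  have hphi : phiK K x ≠ 0 := by
    intro h0
    rw [h0, mul_zero] at e1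
    rw [e1] at e3
    exact (mul_ne_zero hpos.ne' hRx) e3.symm
  have e4 : Q.eval x * phiK K x = h * R.eval x := by rw [← e1, e3]
  have e5 : Q.eval x = R.eval x * (1 + h * T) := by
    have : h * Q.eval x = h * (R.eval x * (1 + h * T)) := by
      have : h * Q.eval x = h * R.eval x + (derivative Q).eval x := by rw [← e3, e2]; ring
      rw [this, hint]; ring
    exact mul_left_cancel₀ hpos.ne' this
  have e6 : (1 + h * T) * phiK K x = h := by
    apply mul_left_cancel₀ hRx
    rw [← mul_assoc, ← e5, e4]; ring
  field_simp
  linarith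

lemma const_identity {K : ℕ} (hK : 1 ≤ K) (v : ℕ → ℝ) (hv0 : v 0 = 1)
    (hv1 : ∀ i, 1 ≤ i → i < K → v i ≤ 0)
    (hinj : Set.InjOn v (Finset.range K : Set ℕ))
    (hv : ∀ i < K, ∀ k : ℕ, (k : ℝ) + v i ≠ 0) (hroot : ∀ i < K, phiK K (v i) = 0) :
    1 / harm K + ∑ i ∈ Finset.Ico 1 K,
      1 / (∑ k ∈ Finset.range K, 1 / ((k : ℝ) + v i) ^ 2) / (1 - v i) =
    (∑ k ∈ Finset.range K, 1 / ((k : ℝ) + 1) ^ 3) /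
      (∑ k ∈ Finset.range K, 1 / ((k : ℝ) + 1) ^ 2) ^ 2 := by
  have hne : (Finset.range K).Nonempty := by simpa using (by omega : K ≠ 0)
  let F : ℝ → ℝ := fun x => 1 / harm K + ∑ i ∈ Finset.Ico 1 K,
      1 / (∑ k ∈ Finset.range K, 1 / ((k : ℝ) + v i) ^ 2) / (x - v i)
  let g : ℝ → ℝ := fun x => ∑ k ∈ Finset.range K, 1 / (((k : ℝ) + 1) * (k + x))
  let g2 : ℝ → ℝ := fun x => ∑ k ∈ Finset.range K, 1 / (((k : ℝ) + 1) ^ 2 * (k + x))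
  have hg1 : 0 < g 1 := Finset.sum_pos (fun k _ => by positivity) hne
  have hF : ContinuousAt F 1 := by
    apply ContinuousAt.add continuousAt_const
    apply tendsto_finsetSum
    intro i hi
    have hi' := Finset.mem_Ico.1 hi
    apply ContinuousAt.div continuousAt_const (by fun_prop)
    have := hv1 i hi'.1 hi'.2
    linarith
  have hg : ContinuousAt g 1 := by
    apply tendsto_finsetSum
    intro k hi
    apply ContinuousAt.div continuousAt_const (by fun_prop)
    positivity
  have hg2 : ContinuousAt g2 1 := by
    apply tendsto_finsetSum
    intro k hi
    apply ContinuousAt.div continuousAt_const (by fun_prop)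
    positivity
  have hG : ContinuousAt (fun x => g2 x / (g x * g 1)) 1 :=
    hg2.div (hg.mul continuousAt_const) (by positivity)
  have heq : F =ᶠ[𝓝[≠] 1] (fun x => g2 x / (g x * g 1)) := by
    filter_upwards [self_mem_nhdsWithin, nhdsWithin_le_nhds (Ioi_mem_nhds (zero_lt_one' ℝ))]
      with x hx1 hx0
    have hx0' : 0 < x := hx0
    have hx1' : x - 1 ≠ 0 := sub_ne_zero.2 hx1
    have hgx : 0 < g x := Finset.sum_pos (fun k _ => by positivity) hne
    have hpf := partial_fractions hK v hinj hv hroot (x := x) (fun k => by positivity) (by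
      intro i hi
      rcases Nat.eq_zero_or_pos i with h | h
      · rw [h, hv0]; exact hx1
      · have := hv1 i h hi
        linarith)
    rw [Finset.range_eq_Ico, Finset.sum_eq_sum_Ico_succ_bot (by omega), hv0,
      ← Finset.range_eq_Ico] at hpf
    have hD0 : (∑ k ∈ Finset.range K, 1 / ((k : ℝ) + 1) ^ 2) = g 1 := by
      apply Finset.sum_congr rfl
      intro k _; rw [sq]
    have hphi : phiK K x = (x - 1) * g x := by
      simp only [phiK, g]
      rw [Finset.mul_sum]
      apply Finset.sum_congr rfl
      intro k _
      have : (k : ℝ) + x ≠ 0 := by positivity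
      have : (k : ℝ) + 1 ≠ 0 := by positivity
      field_simp
      ring
    have hgg : g 1 - g x = (x - 1) * g2 x := by
      simp only [g, g2]
      rw [Finset.mul_sum, ← Finset.sum_sub_distrib]
      apply Finset.sum_congr rfl
      intro k _
      have : (k : ℝ) + x ≠ 0 := by positivity
      have : (k : ℝ) + 1 ≠ 0 := by positivity
      field_simp
      ring
    have e : F x = 1 / phiK K x - 1 / g 1 / (x - 1) := by
      rw [hpf, hD0]
      simp only [F]
      ring
    rw [e, hphi]
    have e2 : g2 x = (g 1 - g x) / (x - 1) := by rw [hgg]; field_simp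
    rw [e2]
    field_simp
  have h1 : Tendsto F (𝓝[≠] 1) (𝓝 (F 1)) := hF.tendsto.mono_left nhdsWithin_le_nhds
  have h2 : Tendsto (fun x => g2 x / (g x * g 1)) (𝓝[≠] 1) (𝓝 (g2 1 / (g 1 * g 1))) :=
    hG.tendsto.mono_left nhdsWithin_le_nhds
  have h3 := tendsto_nhds_unique (h1.congr' heq) h2
  simp only [F, g, g2] at h3
  rw [h3, ← sq]
  simp only [← pow_succ, ← sq]

/-- `w * B(w, m+1)` as a product. -/
noncomputable def betaP (m : ℕ) (w : ℝ) : ℝ := ∏ k ∈ Finset.range m, ((k : ℝ) + 1) / ((k : ℝ) + 1 + w)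

lemma alt_sum (m : ℕ) : ∀ w : ℝ, 0 < w →
    ∑ j ∈ Finset.range (m + 1), (-1 : ℝ) ^ j * (m.choose j) / ((j : ℝ) + w) = betaP m w / w := by
  induction m with
  | zero => intro w hw; simp [betaP]
  | succ m ih =>
    intro w hw
    have hstep : ∑ j ∈ Finset.range (m + 1 + 1), (-1 : ℝ) ^ j * ((m + 1).choose j) / ((j : ℝ) + w) =
        (∑ j ∈ Finset.range (m + 1), (-1 : ℝ) ^ j * (m.choose j) / ((j : ℝ) + w)) -
        (∑ j ∈ Finset.range (m + 1), (-1 : ℝ) ^ j * (m.choose j) / ((j : ℝ) + (w + 1))) := by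
      rw [Finset.sum_range_succ']
      have h1 : ∑ j ∈ Finset.range (m + 1), (-1 : ℝ) ^ j * (m.choose j) / ((j : ℝ) + w) =
        ∑ j ∈ Finset.range (m + 1), (-1 : ℝ) ^ (j + 1) * (m.choose (j + 1)) / (((j + 1 : ℕ) : ℝ) + w)
          + (-1 : ℝ) ^ 0 * (m.choose 0) / (((0 : ℕ) : ℝ) + w) := by
        rw [← Finset.sum_range_succ' (fun j : ℕ => (-1 : ℝ) ^ j * (m.choose j) / ((j : ℝ) + w)),
          Finset.sum_range_succ _ (m + 1)]
        simp
      rw [h1]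
      have h2 : ∀ j ∈ Finset.range (m + 1),
          (-1 : ℝ) ^ (j + 1) * ((m + 1).choose (j + 1)) / (((j + 1 : ℕ) : ℝ) + w) =
          (-1 : ℝ) ^ (j + 1) * (m.choose (j + 1)) / (((j + 1 : ℕ) : ℝ) + w) -
          (-1 : ℝ) ^ j * (m.choose j) / ((j : ℝ) + (w + 1)) := by
        intro j _
        rw [Nat.choose_succ_succ]
        push_cast
        have : (j : ℝ) + 1 + w = j + (w + 1) := by ring
        rw [this]
        ring
      rw [Finset.sum_congr rfl h2, Finset.sum_sub_distrib]
      simp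
      ring
    rw [hstep, ih w hw, ih (w + 1) (by linarith)]
    have hsh : ∀ m : ℕ, betaP m (w + 1) = betaP m w * ((w + 1) / ((m : ℝ) + 1 + w)) := by
      intro m
      induction m with
      | zero => simp only [betaP, Finset.range_zero, Finset.prod_empty, Nat.cast_zero]; field_simp
                ring
      | succ m ihm =>
        have e1 : betaP (m + 1) (w + 1) = betaP m (w + 1) * (((m : ℝ) + 1) / ((m : ℝ) + 1 + (w + 1))) :=
          Finset.prod_range_succ _ _
        have e2 : betaP (m + 1) w = betaP m w * (((m : ℝ) + 1) / ((m : ℝ) + 1 + w)) :=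
          Finset.prod_range_succ _ _
        rw [e1, e2, ihm]
        push_cast
        have : (m : ℝ) + 1 + w ≠ 0 := by positivity
        have : (m : ℝ) + 1 + (w + 1) ≠ 0 := by positivity
        have : (m : ℝ) + 1 + 1 + w ≠ 0 := by positivity
        field_simp
        ring
    have e2 : betaP (m + 1) w = betaP m w * (((m : ℝ) + 1) / ((m : ℝ) + 1 + w)) :=
      Finset.prod_range_succ _ _
    rw [hsh m, e2]
    have : (m : ℝ) + 1 + w ≠ 0 := by positivity
    field_simp
    ring

lemma Icc_shift (m : ℕ) (f : ℕ → ℝ) :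
    ∑ j ∈ Finset.Icc 1 m, f j = ∑ j ∈ Finset.range m, f (j + 1) := by
  rw [Finset.range_eq_Ico, Finset.sum_Ico_add' f 0 m 1]
  rfl

lemma alt_sum' (m : ℕ) {w : ℝ} (hw : 0 < w) :
    ∑ j ∈ Finset.Icc 1 m, (-1 : ℝ) ^ (j - 1) * (m.choose j) * (1 / ((j : ℝ) + w)) =
      (1 - betaP m w) / w := by
  have h := alt_sum m w hw
  rw [Finset.sum_range_succ'] at h
  rw [Icc_shift]
  have : ∀ j ∈ Finset.range m, (-1 : ℝ) ^ (j + 1) * (m.choose (j + 1)) / (((j + 1 : ℕ) : ℝ) + w) =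
    - ((-1 : ℝ) ^ (j + 1 - 1) * (m.choose (j + 1)) * (1 / (((j + 1 : ℕ) : ℝ) + w))) := by
    intro j _
    rw [Nat.add_sub_cancel, pow_succ]
    ring
  rw [Finset.sum_congr rfl this, Finset.sum_neg_distrib] at h
  simp at h
  simp
  rw [sub_div, ← h]
  field_simp
  ring

lemma alt_one {m : ℕ} (hm : 1 ≤ m) :
    ∑ j ∈ Finset.Icc 1 m, (-1 : ℝ) ^ (j - 1) * (m.choose j) = 1 := by
  have h := Int.alternating_sum_range_choose_of_ne (n := m) (by omega)
  have h' : ∑ j ∈ Finset.range (m + 1), (-1 : ℝ) ^ j * (m.choose j) = 0 := by exact_mod_cast h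
  rw [Finset.sum_range_succ'] at h'
  rw [Icc_shift]
  have : ∀ j ∈ Finset.range m, (-1 : ℝ) ^ (j + 1) * (m.choose (j + 1)) =
    - ((-1 : ℝ) ^ (j + 1 - 1) * (m.choose (j + 1))) := by
    intro j _
    rw [Nat.add_sub_cancel, pow_succ]
    ring
  rw [Finset.sum_congr rfl this, Finset.sum_neg_distrib] at h'
  simp only [pow_zero, Nat.choose_zero_right, Nat.cast_one, mul_one] at h'
  linarith

lemma alt_harm (m : ℕ) :
    ∑ j ∈ Finset.Icc 1 m, (-1 : ℝ) ^ (j - 1) * (m.choose j) * (1 / (j : ℝ)) = harm m := by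
  induction m with
  | zero => simp [harm]
  | succ m ih =>
    rw [Icc_shift] at ih ⊢
    have h1 : harm (m + 1) = harm m + 1 / ((m : ℝ) + 1) := Finset.sum_range_succ _ _
    have h2 : ∀ j ∈ Finset.range (m + 1),
        (-1 : ℝ) ^ (j + 1 - 1) * ((m + 1).choose (j + 1)) * (1 / ((j + 1 : ℕ) : ℝ)) =
        (-1 : ℝ) ^ j * (m.choose j) / ((j : ℝ) + 1) +
        (-1 : ℝ) ^ (j + 1 - 1) * (m.choose (j + 1)) * (1 / ((j + 1 : ℕ) : ℝ)) := by
      intro j _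
      rw [Nat.choose_succ_succ, Nat.add_sub_cancel]
      push_cast
      ring
    rw [Finset.sum_congr rfl h2, Finset.sum_add_distrib, alt_sum m 1 one_pos, h1,
      Finset.sum_range_succ _ m, ih]
    have h3 : ∀ m : ℕ, betaP m 1 = 1 / ((m : ℝ) + 1) := by
      intro m
      induction m with
      | zero => simp [betaP]
      | succ m ihm =>
        have e2 : betaP (m + 1) 1 = betaP m 1 * (((m : ℝ) + 1) / ((m : ℝ) + 1 + 1)) :=
          Finset.prod_range_succ _ _
        rw [e2, ihm]
        push_cast
        field_simp
    rw [h3]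
    simp
    ring

lemma betaP_pos (m : ℕ) {w : ℝ} (hw : 0 < w) : 0 < betaP m w :=
  Finset.prod_pos (fun k _ => by positivity)

lemma betaP_anti (m : ℕ) {w w' : ℝ} (hw : 0 < w) (h : w ≤ w') : betaP m w' ≤ betaP m w := by
  apply Finset.prod_le_prod
  · intro k _
    have : 0 < w' := by linarith
    positivity
  · intro k _
    gcongr

lemma betaP_Gamma (m : ℕ) {w : ℝ} (hw : 0 < w) :
    Real.Gamma w * (Real.Gamma ((m + 1 : ℕ) : ℝ) / Real.Gamma (((m + 1 : ℕ) : ℝ) + w)) =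
      betaP m w / w := by
  induction m with
  | zero =>
    simp only [betaP, Finset.range_zero, Finset.prod_empty, zero_add, Nat.cast_one, Real.Gamma_one]
    rw [add_comm, Real.Gamma_add_one hw.ne']
    have := (Real.Gamma_pos_of_pos hw).ne'
    field_simp
  | succ m ih =>
    have e2 : betaP (m + 1) w = betaP m w * (((m : ℝ) + 1) / ((m : ℝ) + 1 + w)) :=
      Finset.prod_range_succ _ _
    have h1 : Real.Gamma ((m + 1 + 1 : ℕ) : ℝ) = ((m + 1 : ℕ) : ℝ) * Real.Gamma ((m + 1 : ℕ) : ℝ) := by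
      rw [Nat.cast_succ (m + 1), Real.Gamma_add_one (by positivity)]
    have h2 : Real.Gamma (((m + 1 + 1 : ℕ) : ℝ) + w) =
        (((m + 1 : ℕ) : ℝ) + w) * Real.Gamma (((m + 1 : ℕ) : ℝ) + w) := by
      rw [← Real.Gamma_add_one (by positivity)]
      congr 1
      push_cast; ring
    rw [h1, h2, e2, mul_div_right_comm (betaP m w), ← ih]
    have h3 : 0 < Real.Gamma (((m + 1 : ℕ) : ℝ) + w) := Real.Gamma_pos_of_pos (by positivity)
    push_cast at h3 ⊢
    have h4 : (m : ℝ) + 1 + w ≠ 0 := by positivity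
    field_simp

lemma betaP_bound {w : ℝ} (hw : 0 < w) : ∃ C, 0 ≤ C ∧ ∀ m : ℕ, 1 ≤ m →
    betaP m w ≤ C * ((m + 1 : ℕ) : ℝ) ^ (-w) := by
  obtain ⟨B, hB⟩ := (Real.GammaSeq_tendsto_Gamma w).bddAbove_range
  have hprod : ∀ m : ℕ, betaP m w * ∏ j ∈ Finset.range (m + 1), (w + (j : ℝ)) = w * (m.factorial : ℝ) := by
    intro m
    induction m with
    | zero => simp [betaP]
    | succ m ih =>
      have e2 : betaP (m + 1) w = betaP m w * (((m : ℝ) + 1) / ((m : ℝ) + 1 + w)) :=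
        Finset.prod_range_succ _ _
      rw [Finset.prod_range_succ, e2, Nat.factorial_succ]
      push_cast
      have h4 : (m : ℝ) + 1 + w ≠ 0 := by positivity
      calc _ = (betaP m w * ∏ j ∈ Finset.range (m + 1), (w + (j : ℝ))) * ((m : ℝ) + 1) := by
            field_simp
            ring
        _ = _ := by rw [ih]; ring
  have hs : ∀ m : ℕ, 1 ≤ m → betaP m w ≤ w * B * (m : ℝ) ^ (-w) := by
    intro m hm
    have h1 : Real.GammaSeq w m ≤ B := hB ⟨m, rfl⟩
    have hm0 : (0 : ℝ) < m := by exact_mod_cast hm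
    have hp : 0 < ∏ j ∈ Finset.range (m + 1), (w + (j : ℝ)) :=
      Finset.prod_pos (fun j _ => by positivity)
    have hpw : 0 < (m : ℝ) ^ w := Real.rpow_pos_of_pos hm0 _
    rw [Real.GammaSeq, div_le_iff₀ hp] at h1
    rw [Real.rpow_neg hm0.le, ← div_eq_mul_inv, le_div_iff₀ hpw]
    have h2 := hprod m
    refine le_of_mul_le_mul_right ?_ hp
    calc betaP m w * (m : ℝ) ^ w * ∏ j ∈ Finset.range (m + 1), (w + (j : ℝ))
        = (betaP m w * ∏ j ∈ Finset.range (m + 1), (w + (j : ℝ))) * (m : ℝ) ^ w := by ring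
      _ = w * ((m : ℝ) ^ w * (m.factorial : ℝ)) := by rw [h2]; ring
      _ ≤ w * (B * ∏ j ∈ Finset.range (m + 1), (w + (j : ℝ))) := by gcongr
      _ = _ := by ring
  have hwB : 0 ≤ w * B := by
    have h1 := hs 1 le_rfl
    have h2 := betaP_pos 1 hw
    simp at h1
    linarith
  refine ⟨w * B * 2 ^ w, by positivity, ?_⟩
  intro m hm
  refine (hs m hm).trans ?_
  rw [mul_assoc (w * B)]
  refine mul_le_mul_of_nonneg_left ?_ hwB
  have hm0 : (0 : ℝ) < m := by exact_mod_cast hm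
  rw [Real.rpow_neg hm0.le, Real.rpow_neg (by positivity), ← div_eq_mul_inv, inv_eq_one_div,
    div_le_div_iff₀ (by positivity) (by positivity), one_mul, ← Real.mul_rpow (by positivity) (by positivity)]
  apply Real.rpow_le_rpow (by positivity) _ hw.le
  have : (1 : ℝ) ≤ m := by exact_mod_cast hm
  push_cast
  linarith

lemma exists_root {K i : ℕ} (hi : 1 ≤ i) (hiK : i < K) :
    ∃ r ∈ Set.Ioo (-(i : ℝ)) (-(i : ℝ) + 1), phiK K r = 0 := by
  set A := ((Finset.range K).erase i).erase (i - 1) with hA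
  have hmem1 : i ∈ Finset.range K := Finset.mem_range.2 hiK
  have hmem2 : i - 1 ∈ (Finset.range K).erase i :=
    Finset.mem_erase.2 ⟨by omega, Finset.mem_range.2 (by omega)⟩
  have hcast : ((i - 1 : ℕ) : ℝ) = (i : ℝ) - 1 := by
    rw [Nat.cast_sub hi]; simp
  let rest : ℝ → ℝ := fun x => ∑ k ∈ A, (1 / ((k : ℝ) + 1) - 1 / ((k : ℝ) + x))
  let f : ℝ → ℝ := fun x => (x + i) * (x + i - 1) *
    (rest x + 1 / ((i : ℝ) + 1) + 1 / (i : ℝ)) - (x + i - 1) - (x + i)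
  have hAne : ∀ k ∈ A, ∀ x ∈ Set.Icc (-(i : ℝ)) (-(i : ℝ) + 1), (k : ℝ) + x ≠ 0 := by
    intro k hk x hx
    rw [hA, Finset.mem_erase, Finset.mem_erase] at hk
    obtain ⟨h1, h2, _⟩ := hk
    rcases lt_or_gt_of_ne h2 with h | h
    · have h3 : k + 1 < i := by omega
      have h4 : (k : ℝ) + 1 < i := by exact_mod_cast h3
      linarith [hx.2]
    · have h4 : (i : ℝ) < k := by exact_mod_cast h
      linarith [hx.1]
  have hcont : ContinuousOn f (Set.Icc (-(i : ℝ)) (-(i : ℝ) + 1)) := by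
    have hrest : ContinuousOn rest (Set.Icc (-(i : ℝ)) (-(i : ℝ) + 1)) := by
      apply continuousOn_finsetSum
      intro k hk
      apply ContinuousOn.sub continuousOn_const
      apply ContinuousOn.div continuousOn_const (by fun_prop)
      exact fun x hx => hAne k hk x hx
    fun_prop
  have hle : -(i : ℝ) ≤ -(i : ℝ) + 1 := by linarith
  have hivt := intermediate_value_Ioo' hle hcont
  have h0 : (0 : ℝ) ∈ Set.Ioo (f (-(i : ℝ) + 1)) (f (-(i : ℝ))) := by
    constructor
    · simp [f]
    · simp [f]
  obtain ⟨r, hr, hfr⟩ := hivt h0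
  refine ⟨r, hr, ?_⟩
  have hphi : phiK K r = rest r + (1 / ((i - 1 : ℕ) + 1 : ℝ) - 1 / ((i - 1 : ℕ) + r : ℝ)) +
      (1 / ((i : ℝ) + 1) - 1 / ((i : ℝ) + r)) := by
    rw [phiK, ← Finset.sum_erase_add _ _ hmem1, ← Finset.sum_erase_add _ _ hmem2]
  have n1 : r + i ≠ 0 := by linarith [hr.1]
  have n2 : r + i - 1 ≠ 0 := by linarith [hr.2]
  have hff : f r = (r + i) * (r + i - 1) * phiK K r := by
    rw [hphi, hcast]
    have e1 : (i : ℝ) - 1 + r = r + i - 1 := by ring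
    have e2 : (i : ℝ) - 1 + 1 = i := by ring
    rw [e1, e2, add_comm (i : ℝ) r]
    simp only [f]
    have c1 : (r + i) * (1 / (r + i)) = 1 := mul_one_div_cancel n1
    have c2 : (r + i - 1) * (1 / (r + i - 1)) = 1 := mul_one_div_cancel n2
    linear_combination (r + i - 1) * c1 + (r + i) * c2
  rw [hff] at hfr
  exact (mul_eq_zero.1 hfr).resolve_left (mul_ne_zero n1 n2)

lemma phiK_one (K : ℕ) : phiK K 1 = 0 := by simp [phiK]

/-- Exact formula for the truncated sum. -/
lemma trunc_identity {K m : ℕ} (hK : 1 ≤ K) (hm : 1 ≤ m) (v : ℕ → ℝ) (hv0 : v 0 = 1)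
    (hv1 : ∀ i, 1 ≤ i → i < K → v i ≤ 0)
    (hinj : Set.InjOn v (Finset.range K : Set ℕ))
    (hv : ∀ i < K, ∀ k : ℕ, (k : ℝ) + v i ≠ 0) (hroot : ∀ i < K, phiK K (v i) = 0) :
    ∑ j ∈ Finset.Icc 1 m, (-1 : ℝ) ^ (j - 1) * (m.choose j) / phiK K ((j : ℝ) + 1) =
    1 / (∑ k ∈ Finset.range K, 1 / ((k : ℝ) + 1) ^ 2) * harm m +
    (∑ k ∈ Finset.range K, 1 / ((k : ℝ) + 1) ^ 3) /
      (∑ k ∈ Finset.range K, 1 / ((k : ℝ) + 1) ^ 2) ^ 2 -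
    ∑ i ∈ Finset.Ico 1 K,
      1 / (∑ k ∈ Finset.range K, 1 / ((k : ℝ) + v i) ^ 2) / (1 - v i) * betaP m (1 - v i) := by
  rw [← const_identity hK v hv0 hv1 hinj hv hroot]
  set c : ℕ → ℝ := fun i => 1 / (∑ k ∈ Finset.range K, 1 / ((k : ℝ) + v i) ^ 2) with hc
  have hc0 : 1 / (∑ k ∈ Finset.range K, 1 / ((k : ℝ) + 1) ^ 2) = c 0 := by
    simp only [hc, hv0]
  have hpf : ∀ j ∈ Finset.Icc 1 m,
      (-1 : ℝ) ^ (j - 1) * (m.choose j) / phiK K ((j : ℝ) + 1) =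
      1 / harm K * ((-1 : ℝ) ^ (j - 1) * (m.choose j)) +
      c 0 * ((-1 : ℝ) ^ (j - 1) * (m.choose j) * (1 / (j : ℝ))) +
      ∑ i ∈ Finset.Ico 1 K,
        c i * ((-1 : ℝ) ^ (j - 1) * (m.choose j) * (1 / ((j : ℝ) + (1 - v i)))) := by
    intro j hj
    have hj1 : (1 : ℝ) ≤ j := by exact_mod_cast (Finset.mem_Icc.1 hj).1
    have h := partial_fractions hK v hinj hv hroot (x := (j : ℝ) + 1) (fun k => by positivity) (by
      intro i hi
      rcases Nat.eq_zero_or_pos i with h | h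
      · rw [h, hv0]; linarith
      · have := hv1 i h hi
        linarith)
    rw [div_eq_mul_one_div, h, Finset.range_eq_Ico, Finset.sum_eq_sum_Ico_succ_bot (by omega),
      ← Finset.range_eq_Ico, hv0, hc0, zero_add, mul_add, mul_add, Finset.mul_sum, ← add_assoc]
    congr 1
    · congr 1
      · ring
      · rw [add_sub_cancel_right]; ring
    · apply Finset.sum_congr rfl
      intro i _
      have : (j : ℝ) + 1 - v i = j + (1 - v i) := by ring
      rw [this]
      simp only [hc]
      ring
  rw [Finset.sum_congr rfl hpf, Finset.sum_add_distrib, Finset.sum_add_distrib, ← Finset.mul_sum,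
    ← Finset.mul_sum, alt_one hm, alt_harm, Finset.sum_comm, hc0]
  have h2 : ∀ i ∈ Finset.Ico 1 K, ∑ j ∈ Finset.Icc 1 m,
      c i * ((-1 : ℝ) ^ (j - 1) * (m.choose j) * (1 / ((j : ℝ) + (1 - v i)))) =
      c i / (1 - v i) - c i / (1 - v i) * betaP m (1 - v i) := by
    intro i hi
    have hi' := Finset.mem_Ico.1 hi
    have := hv1 i hi'.1 hi'.2
    rw [← Finset.mul_sum, alt_sum' m (by linarith)]
    ring
  rw [Finset.sum_congr rfl h2, Finset.sum_sub_distrib]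
  ring

lemma root_close {K i : ℕ} (hi : i < K) {s r : ℝ}
    (hs : s ∈ Set.Ioo (-(i : ℝ)) (-(i : ℝ) + 1)) (hr : r ∈ Set.Ioo (-(i : ℝ)) (-(i : ℝ) + 1))
    (h0 : phiK K r = 0) : |r - s| ≤ |phiK K s| := by
  have hsign : ∀ k : ℕ, 0 < ((k : ℝ) + s) * (k + r) := by
    intro k
    rcases le_or_gt i k with h | h
    · have : (i : ℝ) ≤ k := by exact_mod_cast h
      exact mul_pos (by linarith [hs.1]) (by linarith [hr.1])
    · have : (k : ℝ) + 1 ≤ i := by exact_mod_cast h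
      exact mul_pos_of_neg_of_neg (by linarith [hs.2]) (by linarith [hr.2])
  have e : phiK K s = (s - r) * ∑ k ∈ Finset.range K, 1 / (((k : ℝ) + s) * (k + r)) := by
    rw [← sub_zero (phiK K s), ← h0, phiK, phiK, ← Finset.sum_sub_distrib, Finset.mul_sum]
    apply Finset.sum_congr rfl
    intro k _
    have h1 := left_ne_zero_of_mul (hsign k).ne'
    have h2 := right_ne_zero_of_mul (hsign k).ne'
    rw [sub_sub_sub_cancel_left, div_sub_div _ _ h2 h1, mul_one_div, mul_comm ((k : ℝ) + r) (k + s)]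
    congr 1
    ring
  have hge : 1 ≤ ∑ k ∈ Finset.range K, 1 / (((k : ℝ) + s) * (k + r)) := by
    have h1 : 1 ≤ 1 / (((i : ℝ) + s) * (i + r)) := by
      rw [le_div_iff₀ (hsign i), one_mul]
      have a1 := hs.1; have a2 := hs.2; have b1 := hr.1; have b2 := hr.2
      exact mul_le_one₀ (by linarith) (by linarith) (by linarith)
    refine h1.trans (Finset.single_le_sum (f := fun k : ℕ => 1 / (((k : ℝ) + s) * (k + r))) ?_
      (Finset.mem_range.2 hi))
    intro k _
    exact (one_div_pos.2 (hsign k)).le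
  rw [e, abs_mul, abs_sub_comm]
  exact le_mul_of_one_le_right (abs_nonneg _) (hge.trans (le_abs_self _))

lemma tendsto_D {i : ℕ} {s : ℝ} (hs : s ∈ Set.Ioo (-(i : ℝ)) (-(i : ℝ) + 1)) {r : ℕ → ℝ}
    (hr : Tendsto r atTop (𝓝 s)) :
    Tendsto (fun K => ∑ k ∈ Finset.range K, 1 / ((k : ℝ) + r K) ^ 2) atTop
      (𝓝 (∑' k : ℕ, 1 / ((k : ℝ) + s) ^ 2)) := by
  obtain ⟨d, hd, hw⟩ := window hs
  have hev : ∀ᶠ K in atTop, |r K - s| < d / 2 := by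
    have := Metric.tendsto_nhds.1 hr (d / 2) (by positivity)
    simpa [Real.dist_eq] using this
  have h := tendsto_tsum_of_dominated_convergence (𝓕 := atTop)
    (f := fun (K : ℕ) (k : ℕ) => if k ∈ Finset.range K then 1 / ((k : ℝ) + r K) ^ 2 else 0)
    (g := fun k : ℕ => 1 / ((k : ℝ) + s) ^ 2)
    (bound := fun k : ℕ => 4 * (1 / ((k : ℝ) + s) ^ 2)) ((summable_sq s).mul_left 4) ?_ ?_
  · refine h.congr ?_
    intro K
    rw [tsum_eq_sum (s := Finset.range K)]
    · apply Finset.sum_congr rfl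
      intro k hk
      rw [if_pos hk]
    · intro k hk
      rw [if_neg hk]
  · intro k
    have hne : (k : ℝ) + s ≠ 0 := abs_pos.1 (hd.trans_le (hw k))
    have h1 : Tendsto (fun K => 1 / ((k : ℝ) + r K) ^ 2) atTop (𝓝 (1 / ((k : ℝ) + s) ^ 2)) :=
      Tendsto.div tendsto_const_nhds ((hr.const_add _).pow 2) (by positivity)
    refine h1.congr' ?_
    filter_upwards [eventually_gt_atTop k] with K hK
    rw [if_pos (Finset.mem_range.2 hK)]
  · filter_upwards [hev] with K hK k
    split_ifs
    · rw [Real.norm_of_nonneg (by positivity)]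
      exact (window_bound hd hw hK k).2
    · rw [norm_zero]; positivity

lemma tendsto_zeta2 : Tendsto (fun K : ℕ => ∑ k ∈ Finset.range K, 1 / ((k : ℝ) + 1) ^ 2) atTop
    (𝓝 (Real.pi ^ 2 / 6)) := by
  have h := (hasSum_nat_add_iff' 1).2 hasSum_zeta_two
  simp at h
  have := h.tendsto_sum_nat
  simpa using this

lemma tendsto_zeta3 : Tendsto (fun K : ℕ => ∑ k ∈ Finset.range K, 1 / ((k : ℝ) + 1) ^ 3) atTop
    (𝓝 zeta3) := by
  have h : Summable (fun k : ℕ => 1 / ((k : ℝ) + 1) ^ 3) := by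
    have := (summable_nat_add_iff 1).2 (Real.summable_one_div_nat_pow.2 (by norm_num : 1 < 3))
    simpa using this
  exact h.hasSum.tendsto_sum_nat

lemma continuousAt_betaP (m : ℕ) {w : ℝ} (hw : 0 < w) : ContinuousAt (betaP m) w := by
  unfold betaP
  apply tendsto_finsetProd
  intro k _
  apply ContinuousAt.div continuousAt_const (by fun_prop)
  positivity

/--
Let `S(n) := Σ_{j=1}^{n-1} (-1)^{j-1} C(n-1, j) / h_j`. Let `0 > s₁ > s₂ > ...` be the negative
roots of `ψ(s) = ψ(1)`, with `s_i ∈ (-i, -(i-1))`. Then for every fixed integer `N ≥ 0` there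
is a constant `C_N` such that for all `n ≥ 2`,
`|S(n) - (6/π²)·h_{n-1} - ζ(3)/ζ(2)² + Σ_{i=1}^N (Γ(|s_i|+1)/ψ'(s_i)) · Γ(n)/Γ(n+|s_i|+1)|
  ≤ C_N · n^{-1-|s_{N+1}|}`.
-/
theorem stmt12 (s : ℕ → ℝ)
    (hs : ∀ i : ℕ, 1 ≤ i →
      s i ∈ Set.Ioo (-(i : ℝ)) (-(i : ℝ) + 1) ∧ digamma (s i) = digamma 1)
    (N : ℕ) :
    ∃ C : ℝ, ∀ n : ℕ, 2 ≤ n →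
      |S n - (6 / Real.pi ^ 2) * harm (n - 1) - zeta3 / (Real.pi ^ 2 / 6) ^ 2
          + ∑ i ∈ Finset.Icc 1 N,
              (Real.Gamma (|s i| + 1) / deriv digamma (s i)) *
                (Real.Gamma (n : ℝ) / Real.Gamma ((n : ℝ) + |s i| + 1))|
        ≤ C * (n : ℝ) ^ (-1 - |s (N + 1)|) := by
  have hneg : ∀ i, 1 ≤ i → s i < 0 := by
    intro i hi
    have h1 : (1 : ℝ) ≤ i := by exact_mod_cast hi
    linarith [(hs i hi).1.2]
  -- roots of the truncated functions
  have hex : ∀ K i : ℕ, ∃ r : ℝ, (i = 0 → r = 1) ∧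
      (1 ≤ i → r ∈ Set.Ioo (-(i : ℝ)) (-(i : ℝ) + 1)) ∧ (i < K → phiK K r = 0) := by
    intro K i
    rcases Nat.eq_zero_or_pos i with h | h
    · exact ⟨1, fun _ => rfl, fun h' => by omega, fun _ => phiK_one K⟩
    · rcases lt_or_ge i K with h' | h'
      · obtain ⟨r, hr, hr0⟩ := exists_root h h'
        exact ⟨r, fun h0 => by omega, fun _ => hr, fun _ => hr0⟩
      · exact ⟨-(i : ℝ) + 1 / 2, fun h0 => by omega,
          fun _ => ⟨by linarith, by linarith⟩, fun h0 => by omega⟩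
  choose v hv0 hvI hvroot using hex
  have hvlt : ∀ K i j : ℕ, i < j → v K j < v K i := by
    intro K i j hij
    have hj := hvI K j (by omega)
    rcases Nat.eq_zero_or_pos i with h | h
    · rw [hv0 K i h]
      have : (1 : ℝ) ≤ j := by exact_mod_cast (by omega : 1 ≤ j)
      linarith [hj.2]
    · have hi := hvI K i h
      have : (i : ℝ) + 1 ≤ j := by exact_mod_cast hij
      linarith [hj.2, hi.1]
  have hvinj : ∀ K, Function.Injective (v K) := by
    intro K i j hij
    rcases lt_trichotomy i j with h | h | h
    · exact absurd hij (hvlt K i j h).ne'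
    · exact h
    · exact absurd hij (hvlt K j i h).ne
  have hvneg : ∀ K i, 1 ≤ i → v K i ≤ 0 := by
    intro K i hi
    have h1 : (1 : ℝ) ≤ i := by exact_mod_cast hi
    linarith [(hvI K i hi).2]
  have hvne : ∀ K i, ∀ k : ℕ, (k : ℝ) + v K i ≠ 0 := by
    intro K i k
    rcases Nat.eq_zero_or_pos i with h | h
    · rw [hv0 K i h]; positivity
    · obtain ⟨d, hd, hw⟩ := window (hvI K i h)
      exact abs_pos.1 (hd.trans_le (hw k))
  have hvlim : ∀ i, 1 ≤ i → Tendsto (fun K => v K i) atTop (𝓝 (s i)) := by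
    intro i hi
    have hp : Tendsto (fun K => |phiK K (s i)|) atTop (𝓝 0) := by
      have hne : ∀ m : ℕ, s i ≠ -m := by
        intro m h
        obtain ⟨d, hd, hw⟩ := window (hs i hi).1
        have := hw m
        rw [h, add_neg_cancel, abs_zero] at this
        linarith
      have := (tendsto_phiK hne).abs
      rwa [(hs i hi).2, sub_self, abs_zero] at this
    rw [tendsto_iff_dist_tendsto_zero]
    refine squeeze_zero' (Eventually.of_forall fun _ => dist_nonneg) ?_ hp
    filter_upwards [eventually_gt_atTop i] with K hK
    rw [Real.dist_eq]
    exact root_close hK (hs i hi).1 (hvI K i hi) (hvroot K i hK)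
  let D : ℕ → ℕ → ℝ := fun K i => ∑ k ∈ Finset.range K, 1 / ((k : ℝ) + v K i) ^ 2
  let G : ℕ → ℝ := fun K => (∑ k ∈ Finset.range K, 1 / ((k : ℝ) + 1) ^ 3) /
      (∑ k ∈ Finset.range K, 1 / ((k : ℝ) + 1) ^ 2) ^ 2
  have hDnn : ∀ K i, 0 ≤ D K i := fun K i => Finset.sum_nonneg (fun k _ => by positivity)
  have hDlim : ∀ i, 1 ≤ i → Tendsto (fun K => D K i) atTop (𝓝 (deriv digamma (s i))) := by
    intro i hi
    rw [(hasDerivAt_digamma (hs i hi).1).deriv]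
    exact tendsto_D (hs i hi).1 (hvlim i hi)
  have hDne : ∀ i, 1 ≤ i → deriv digamma (s i) ≠ 0 := by
    intro i hi
    rw [(hasDerivAt_digamma (hs i hi).1).deriv]
    apply ne_of_gt
    obtain ⟨d, hd, hw⟩ := window (hs i hi).1
    have : ((0 : ℕ) : ℝ) + s i ≠ 0 := abs_pos.1 (hd.trans_le (hw 0))
    exact (summable_sq (s i)).tsum_pos (fun k => by positivity) 0 (by positivity)
  set Z := zeta3 / (Real.pi ^ 2 / 6) ^ 2 with hZ
  have hGlim : Tendsto G atTop (𝓝 Z) :=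
    tendsto_zeta3.div (tendsto_zeta2.pow 2) (by positivity)
  have hzpos : 0 < 1 - s (N + 1) := by linarith [hneg (N + 1) (by omega)]
  -- the key bound
  have key : ∀ m : ℕ, 1 ≤ m →
      |S (m + 1) - (6 / Real.pi ^ 2) * harm m - Z + ∑ i ∈ Finset.Icc 1 N,
        1 / deriv digamma (s i) / (1 - s i) * betaP m (1 - s i)| ≤ betaP m (1 - s (N + 1)) * Z := by
    intro m hm
    have hblim : ∀ i, 1 ≤ i → Tendsto (fun K => betaP m (1 - v K i)) atTop
        (𝓝 (betaP m (1 - s i))) := by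
      intro i hi
      have hc := continuousAt_betaP m (w := 1 - s i) (by linarith [hneg i hi])
      exact hc.tendsto.comp ((hvlim i hi).const_sub 1)
    have hSlim : Tendsto (fun K => ∑ j ∈ Finset.Icc 1 m,
        (-1 : ℝ) ^ (j - 1) * (m.choose j) / phiK K ((j : ℝ) + 1)) atTop (𝓝 (S (m + 1))) := by
      unfold S
      rw [Nat.add_sub_cancel]
      apply tendsto_finsetSum
      intro j hj
      have hp : Tendsto (fun K => phiK K ((j : ℝ) + 1)) atTop (𝓝 (harm j)) := by
        rw [← digamma_nat]
        apply tendsto_phiK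
        intro m h
        have : (0 : ℝ) ≤ m := m.cast_nonneg
        have : (0 : ℝ) ≤ j := j.cast_nonneg
        linarith
      refine Tendsto.div tendsto_const_nhds hp ?_
      apply ne_of_gt
      apply Finset.sum_pos (fun k _ => by positivity)
      simpa using (by have := (Finset.mem_Icc.1 hj).1; omega : j ≠ 0)
    have hsumlim : Tendsto (fun K => ∑ i ∈ Finset.Icc 1 N,
        1 / D K i / (1 - v K i) * betaP m (1 - v K i)) atTop (𝓝 (∑ i ∈ Finset.Icc 1 N,
        1 / deriv digamma (s i) / (1 - s i) * betaP m (1 - s i))) := by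
      apply tendsto_finsetSum
      intro i hi
      have hi' := (Finset.mem_Icc.1 hi).1
      refine Tendsto.mul (Tendsto.div (Tendsto.div tendsto_const_nhds (hDlim i hi') (hDne i hi'))
        ((hvlim i hi').const_sub 1) ?_) (hblim i hi')
      linarith [hneg i hi']
    have hz2 : Tendsto (fun K : ℕ => 1 / (∑ k ∈ Finset.range K, 1 / ((k : ℝ) + 1) ^ 2) * harm m)
        atTop (𝓝 ((6 / Real.pi ^ 2) * harm m)) := by
      have : 6 / Real.pi ^ 2 = 1 / (Real.pi ^ 2 / 6) := by rw [one_div_div]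
      rw [this]
      exact (Tendsto.div tendsto_const_nhds tendsto_zeta2 (by positivity)).mul_const _
    have hL := (((hSlim.sub hz2).sub hGlim).add hsumlim).abs
    have hR := (hblim (N + 1) (by omega)).mul hGlim
    refine le_of_tendsto_of_tendsto hL hR ?_
    filter_upwards [eventually_gt_atTop (N + 1)] with K hK
    have hid := trunc_identity (K := K) (by omega) hm (v K) (hv0 K 0 rfl)
      (fun i hi _ => hvneg K i hi) (hvinj K).injOn (fun i _ => hvne K i) (fun i hi => hvroot K i hi)
    have hconst := const_identity (K := K) (by omega) (v K) (hv0 K 0 rfl)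
      (fun i hi _ => hvneg K i hi) (hvinj K).injOn (fun i _ => hvne K i) (fun i hi => hvroot K i hi)
    rw [hid]
    have hsplit : ∀ f : ℕ → ℝ, ∑ i ∈ Finset.Ico 1 K, f i =
        ∑ i ∈ Finset.Icc 1 N, f i + ∑ i ∈ Finset.Ico (N + 1) K, f i := by
      intro f
      rw [← Finset.sum_Ico_consecutive f (by omega : 1 ≤ N + 1) (by omega : N + 1 ≤ K)]
      rfl
    have hterm : ∀ i, 1 ≤ i → 0 ≤ 1 / D K i / (1 - v K i) := by
      intro i hi
      have := hDnn K i
      have : 0 ≤ 1 - v K i := by linarith [hvneg K i hi]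
      positivity
    rw [hsplit] at hconst ⊢
    have htail : ∑ i ∈ Finset.Ico (N + 1) K, 1 / D K i / (1 - v K i) ≤ G K := by
      have h1 : 0 ≤ 1 / harm K := by
        apply one_div_nonneg.2
        exact Finset.sum_nonneg (fun k _ => by positivity)
      have h2 : 0 ≤ ∑ i ∈ Finset.Icc 1 N, 1 / D K i / (1 - v K i) :=
        Finset.sum_nonneg (fun i hi => hterm i (Finset.mem_Icc.1 hi).1)
      simp only [D, G] at h1 h2 ⊢
      linarith
    have hvN : 0 < 1 - v K (N + 1) := by linarith [hvneg K (N + 1) (by omega)]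
    have hbpos : ∀ i, 1 ≤ i → 0 < betaP m (1 - v K i) := by
      intro i hi
      exact betaP_pos m (by linarith [hvneg K i hi])
    set T := ∑ i ∈ Finset.Ico (N + 1) K, 1 / D K i / (1 - v K i) * betaP m (1 - v K i) with hT
    have hT0 : 0 ≤ T := Finset.sum_nonneg (fun i hi => by
      have hi' : 1 ≤ i := by have := (Finset.mem_Ico.1 hi).1; omega
      exact mul_nonneg (hterm i hi') (hbpos i hi').le)
    have hT1 : T ≤ betaP m (1 - v K (N + 1)) * G K := by
      calc T ≤ ∑ i ∈ Finset.Ico (N + 1) K, 1 / D K i / (1 - v K i) * betaP m (1 - v K (N + 1)) := by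
            apply Finset.sum_le_sum
            intro i hi
            have hi' := (Finset.mem_Ico.1 hi).1
            apply mul_le_mul_of_nonneg_left _ (hterm i (by omega))
            apply betaP_anti m hvN
            rcases hi'.eq_or_lt with h | h
            · rw [h]
            · linarith [hvlt K (N + 1) i h]
        _ = betaP m (1 - v K (N + 1)) * ∑ i ∈ Finset.Ico (N + 1) K, 1 / D K i / (1 - v K i) := by
            rw [← Finset.sum_mul, mul_comm]
        _ ≤ _ := mul_le_mul_of_nonneg_left htail (hbpos (N + 1) (by omega)).le
    refine le_trans (le_of_eq ?_) hT1
    refine Eq.trans ?_ (abs_of_nonneg hT0)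
    rw [← abs_neg T]
    congr 1
    simp only [hT, D, G]
    ring
  obtain ⟨C, hC0, hC⟩ := betaP_bound hzpos
  have hZ0 : 0 ≤ Z := by
    have : 0 ≤ zeta3 := tsum_nonneg (fun k => by positivity)
    positivity
  refine ⟨C * Z, ?_⟩
  intro n hn
  obtain ⟨m, rfl⟩ : ∃ m, n = m + 1 := ⟨n - 1, by omega⟩
  have hm : 1 ≤ m := by omega
  have h1 := key m hm
  have habs : ∀ i, 1 ≤ i → |s i| + 1 = 1 - s i := by
    intro i hi
    rw [abs_of_neg (hneg i hi)]; ring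
  have hsum : ∑ i ∈ Finset.Icc 1 N,
              (Real.Gamma (|s i| + 1) / deriv digamma (s i)) *
                (Real.Gamma ((m + 1 : ℕ) : ℝ) / Real.Gamma (((m + 1 : ℕ) : ℝ) + |s i| + 1)) =
      ∑ i ∈ Finset.Icc 1 N, 1 / deriv digamma (s i) / (1 - s i) * betaP m (1 - s i) := by
    apply Finset.sum_congr rfl
    intro i hi
    have hi' := (Finset.mem_Icc.1 hi).1
    have hg := betaP_Gamma m (w := 1 - s i) (by linarith [hneg i hi'])
    rw [add_assoc, habs i hi']
    calc _ = 1 / deriv digamma (s i) * (Real.Gamma (1 - s i) *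
          (Real.Gamma ((m + 1 : ℕ) : ℝ) / Real.Gamma (((m + 1 : ℕ) : ℝ) + (1 - s i)))) := by ring
      _ = _ := by rw [hg]; ring
  have hexp : -1 - |s (N + 1)| = -(1 - s (N + 1)) := by
    rw [← habs (N + 1) (by omega)]; ring
  rw [hsum, hexp, Nat.add_sub_cancel]
  refine h1.trans ?_
  have := mul_le_mul_of_nonneg_right (hC m hm) hZ0
  refine this.trans (le_of_eq ?_)
  ring
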